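/- (Brin–Squier.) Let PL₊([0,1]) denote the group (under composition) of strictly increasing bijections f of the closed interval [0,1] ⊆ ℝ for which there exists a finite subdivision 0 = t₀ < t₁ < ⋯ < t_m = 1 such that f is affine (of the form x ↦ cx + d) on each subinterval [t_{i−1}, t_i]. Then PL₊([0,1]) contains no free subgroup of rank 2: for any f, g ∈ PL₊([0,1]), the homomorphism from the free group on two generators to PL₊([0,1]) sending the generators to f and g is not injective. In particular, Thompson's group F contains no nonabelian free subgroup. -/

import Mathlib

/-- A bijection of the closed interval `[0,1]` is an orientation-preserving
piecewise-affine homeomorphism if it is strictly increasing and affine (`x ↦ c x + d`)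
on each piece of some finite subdivision `0 = t₀ < t₁ < ⋯ < t_m = 1`. -/
def IsPLHomeo (f : Equiv.Perm (Set.Icc (0 : ℝ) 1)) : Prop :=
  StrictMono (fun x : Set.Icc (0 : ℝ) 1 => (f x : ℝ)) ∧
  ∃ (m : ℕ) (t : ℕ → ℝ), 0 < m ∧ t 0 = 0 ∧ t m = 1 ∧
    (∀ i < m, t i < t (i + 1)) ∧
    ∀ i < m, ∃ c d : ℝ, ∀ x : Set.Icc (0 : ℝ) 1,
      t i ≤ (x : ℝ) → (x : ℝ) ≤ t (i + 1) → (f x : ℝ) = c * (x : ℝ) + d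

open Set Filter Topology
open scoped commutatorElement

namespace FreeGroup

theorem eq_of_commute_of {α : Type*} {a b : α} (h : Commute (of a) (of b)) : a = b := by
  classical
  by_contra hab
  have key := h.map (lift fun x : α =>
    if x = a then Equiv.swap (0 : Fin 3) 1 else Equiv.swap (1 : Fin 3) 2)
  simp only [lift_apply_of, if_true, if_neg (Ne.symm hab)] at key
  exact absurd key.eq (by decide)

end FreeGroup

/-- A commutative free group is cyclic. -/
theorem IsFreeGroup.isCyclic_of_commute {G : Type*} [Group G] [IsFreeGroup G]
    (h : ∀ a b : G, Commute a b) : IsCyclic G := by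
  let e := IsFreeGroup.toFreeGroup G
  have hsub : Subsingleton (IsFreeGroup.Generators G) := ⟨fun i j =>
    FreeGroup.eq_of_commute_of <| by
      simpa using (h (e.symm (FreeGroup.of i)) (e.symm (FreeGroup.of j))).map e.toMonoidHom⟩
  suffices IsCyclic (FreeGroup (IsFreeGroup.Generators G)) from
    isCyclic_of_surjective e.symm e.symm.surjective
  rcases isEmpty_or_nonempty (IsFreeGroup.Generators G) with _ | ⟨⟨i⟩⟩
  · infer_instance
  · refine ⟨FreeGroup.of i, fun x => ?_⟩
    induction x using FreeGroup.induction_on with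
    | C1 => exact one_mem (Subgroup.zpowers _)
    | of j => exact Subsingleton.elim i j ▸ Subgroup.mem_zpowers _
    | inv_of j hj => exact inv_mem (S := Subgroup (FreeGroup _)) (s := Subgroup.zpowers _) hj
    | mul x y hx hy => exact mul_mem (S := Subgroup (FreeGroup _)) (s := Subgroup.zpowers _) hx hy

/-- Commuting elements of a free group are powers of a common element. -/
theorem IsFreeGroup.exists_zpow_of_commute {G : Type*} [Group G] [IsFreeGroup G] {a b : G}
    (h : Commute a b) : ∃ (z : G) (m n : ℤ), z ^ m = a ∧ z ^ n = b := by
  let H := Subgroup.closure ({a, b} : Set G)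
  have hcomm : ∀ x ∈ ({a, b} : Set G), ∀ y ∈ ({a, b} : Set G), x * y = y * x := by
    rintro x (rfl | rfl) y (rfl | rfl)
    exacts [rfl, h, h.symm, rfl]
  have hH : ∀ x y : H, Commute x y :=
    (Subgroup.isMulCommutative_closure hcomm).is_comm.comm
  obtain ⟨z, hz⟩ := (IsFreeGroup.isCyclic_of_commute hH).exists_generator
  obtain ⟨m, hm⟩ := hz ⟨a, Subgroup.subset_closure (by simp)⟩
  obtain ⟨n, hn⟩ := hz ⟨b, Subgroup.subset_closure (by simp)⟩
  exact ⟨z, m, n, by simpa using congrArg Subtype.val hm, by simpa using congrArg Subtype.val hn⟩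

namespace OrderIso

variable {X : Type*}

theorem pow_apply_eq_self_iff [LinearOrder X] (e : X ≃o X) {n : ℕ} (hn : 0 < n) (x : X) :
    (e ^ n) x = x ↔ e x = x := by
  have hpow : ⇑(e ^ n) = e^[n] := hom_coe_pow _ rfl (fun _ _ => rfl) e n
  have := (Function.Commute.id_right (f := ⇑e)).iterate_pos_eq_iff_map_eq
    e.monotone strictMono_id (x := x) hn
  simpa [hpow] using this

theorem inv_apply_eq_self_iff [LE X] (e : X ≃o X) (x : X) : e⁻¹ x = x ↔ e x = x :=
  (e.symm_apply_eq (x := x) (y := x)).trans eq_comm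

theorem zpow_apply_eq_self_iff [LinearOrder X] (e : X ≃o X) {n : ℤ} (hn : n ≠ 0) (x : X) :
    (e ^ n) x = x ↔ e x = x := by
  obtain ⟨k, rfl | rfl⟩ := n.eq_nat_or_neg
  · rw [zpow_natCast, pow_apply_eq_self_iff e (by lia)]
  · rw [zpow_neg, zpow_natCast, inv_apply_eq_self_iff, pow_apply_eq_self_iff e (by lia)]

end OrderIso

section Action

variable {G X : Type*} [Group G]

section Hull

variable [LinearOrder X] (ρ : G →* (X ≃o X))

/-- The order-convex hull of the orbit of `s`. -/
def orbitHull (s : X) : Set X := {y | ∃ v w : G, ρ v s ≤ y ∧ y ≤ ρ w s}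

theorem map_mem_orbitHull {s y : X} (k : G) (hy : y ∈ orbitHull ρ s) :
    ρ k y ∈ orbitHull ρ s := by
  obtain ⟨v, w, hv, hw⟩ := hy
  refine ⟨k * v, k * w, ?_, ?_⟩ <;> rw [map_mul] <;> exact (ρ k).monotone ‹_›

theorem apply_inv_self (k : G) (y : X) : ρ k (ρ k⁻¹ y) = y := by
  rw [map_inv]; exact (ρ k).apply_symm_apply y

theorem inv_apply_self (k : G) (y : X) : ρ k⁻¹ (ρ k y) = y := by
  rw [map_inv]; exact (ρ k).symm_apply_apply y

theorem conj_apply_eq_self_iff (k u : G) (y : X) :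
    ρ (k * u * k⁻¹) y = y ↔ ρ u (ρ k⁻¹ y) = ρ k⁻¹ y := by
  have h : ρ (k * u * k⁻¹) y = ρ k (ρ u (ρ k⁻¹ y)) := by simp only [map_mul]; rfl
  rw [h]
  constructor <;> intro h'
  · rw [← inv_apply_self ρ k (ρ u (ρ k⁻¹ y)), h']
  · rw [h', apply_inv_self]

theorem commutator_apply_eq_self_of_commute (u v : G) (y : X)
    (h : ρ u (ρ v (ρ u⁻¹ (ρ v⁻¹ y))) = ρ v (ρ u (ρ u⁻¹ (ρ v⁻¹ y)))) : ρ ⁅u, v⁆ y = y := by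
  have h' : ρ ⁅u, v⁆ y = ρ u (ρ v (ρ u⁻¹ (ρ v⁻¹ y))) := by
    simp only [commutatorElement_def, map_mul]; rfl
  rw [h', h, apply_inv_self, apply_inv_self]

theorem commutator_apply_eq_self_of_disjoint {u v : G} {s : X}
    (h : ∀ y ∈ orbitHull ρ s, ρ u y = y ∨ ρ v y = y) {y : X} (hy : y ∈ orbitHull ρ s) :
    ρ ⁅u, v⁆ y = y := by
  refine commutator_apply_eq_self_of_commute ρ u v y ?_
  have hw := map_mem_orbitHull ρ u⁻¹ (map_mem_orbitHull ρ v⁻¹ hy)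
  generalize ρ u⁻¹ (ρ v⁻¹ y) = w at hw
  by_cases hu : ρ u w = w
  · rw [hu]
    by_cases hv : ρ v w = w
    · rw [hv, hu]
    · exact (h _ (map_mem_orbitHull ρ v hw)).resolve_right fun h' => hv ((ρ v).injective h')
  · rw [(h w hw).resolve_left hu, eq_comm]
    exact (h _ (map_mem_orbitHull ρ u hw)).resolve_left fun h' => hu ((ρ u).injective h')

theorem isOpen_orbitHull [TopologicalSpace X] [OrderTopology X] {s : X}
    (hs : ¬ ∀ v, ρ v s = s) : IsOpen (orbitHull ρ s) := by
  push Not at hs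
  obtain ⟨k, hk⟩ := hs
  have hlt : ∃ a b : G, ρ a s < s ∧ s < ρ b s := by
    rcases hk.lt_or_gt with h | h
    · exact ⟨k, k⁻¹, h, by simpa [inv_apply_self] using (ρ k⁻¹).strictMono h⟩
    · exact ⟨k⁻¹, k, by simpa [inv_apply_self] using (ρ k⁻¹).strictMono h, h⟩
  obtain ⟨a, b, ha, hb⟩ := hlt
  rw [isOpen_iff_mem_nhds]
  rintro y ⟨v, w, hv, hw⟩
  have h1 : ρ (v * a) s < y := by rw [map_mul]; exact ((ρ v).strictMono ha).trans_le hv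
  have h2 : y < ρ (w * b) s := by rw [map_mul]; exact hw.trans_lt ((ρ w).strictMono hb)
  exact mem_of_superset (Ioo_mem_nhds h1 h2) fun z hz => ⟨_, _, hz.1.le, hz.2.le⟩

end Hull

section Order

variable [CompleteLinearOrder X] (ρ : G →* (X ≃o X))

theorem map_sSup_range_orbit (s : X) (k : G) :
    ρ k (sSup (range fun v => ρ v s)) = sSup (range fun v => ρ v s) := by
  rw [sSup_range, (ρ k).map_iSup]
  refine (Equiv.mulLeft k).iSup_congr fun v => ?_
  simp only [Equiv.coe_mulLeft, map_mul]; rfl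

theorem map_sInf_range_orbit (s : X) (k : G) :
    ρ k (sInf (range fun v => ρ v s)) = sInf (range fun v => ρ v s) := by
  rw [sInf_range, (ρ k).map_iInf]
  refine (Equiv.mulLeft k).iInf_congr fun v => ?_
  simp only [Equiv.coe_mulLeft, map_mul]; rfl

variable [TopologicalSpace X] [OrderTopology X]

/-- The subgroup of elements acting trivially near every global fixed point. -/
def trivialNearFixed : Subgroup G where
  carrier := {u | ∀ x, (∀ v, ρ v x = x) → ∀ᶠ y in 𝓝 x, ρ u y = y}
  one_mem' x _ := by simp
  mul_mem' {u v} hu hv x hx := by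
    filter_upwards [hu x hx, hv x hx] with y h1 h2
    rw [map_mul]
    exact (congrArg (ρ u) h2).trans h1
  inv_mem' {u} hu x hx := by
    filter_upwards [hu x hx] with y h1
    rwa [map_inv, OrderIso.inv_apply_eq_self_iff]

instance normal_trivialNearFixed : (trivialNearFixed ρ).Normal where
  conj_mem u hu k x hx := by
    have ht : Tendsto (ρ k⁻¹) (𝓝 x) (𝓝 x) := by
      simpa only [hx] using (ρ k⁻¹).continuous.tendsto x
    filter_upwards [ht.eventually (hu x hx)] with y hy
    exact (conj_apply_eq_self_iff ρ k u y).2 hy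

variable {ρ}

theorem exists_forall_ge_orbit_apply_eq_self {u : G} (hu : u ∈ trivialNearFixed ρ) (s : X) :
    ∃ w, ∀ y ∈ orbitHull ρ s, ρ w s ≤ y → ρ u y = y := by
  set p := sSup (range fun v => ρ v s)
  have hlub : IsLUB (range fun v => ρ v s) p := isLUB_sSup _
  have hev := hu p (map_sSup_range_orbit ρ s)
  have hle : ∀ y ∈ orbitHull ρ s, y ≤ p := fun y ⟨_, w, _, hw⟩ => hw.trans (hlub.1 ⟨w, rfl⟩)
  by_cases hmem : p ∈ range fun v => ρ v s
  · obtain ⟨w, hw⟩ := hmem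
    refine ⟨w, fun y hy hwy => ?_⟩
    have : y = p := le_antisymm (hle y hy) (hw ▸ hwy)
    exact this ▸ hev.self_of_nhds
  · have hlt : s < p := by
      refine lt_of_le_of_ne (hlub.1 ⟨1, by simp⟩) fun h => hmem ⟨1, by simpa using h⟩
    obtain ⟨l, hl, hl'⟩ := exists_Ioc_subset_of_mem_nhds hev ⟨s, hlt⟩
    obtain ⟨_, ⟨w, rfl⟩, hw⟩ := (lt_isLUB_iff hlub).1 hl
    exact ⟨w, fun y hy hwy => hl' ⟨hw.trans_le hwy, hle y hy⟩⟩

theorem exists_forall_le_orbit_apply_eq_self {u : G} (hu : u ∈ trivialNearFixed ρ) (s : X) :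
    ∃ v, ∀ y ∈ orbitHull ρ s, y ≤ ρ v s → ρ u y = y := by
  set p := sInf (range fun v => ρ v s)
  have hglb : IsGLB (range fun v => ρ v s) p := isGLB_sInf _
  have hev := hu p (map_sInf_range_orbit ρ s)
  have hle : ∀ y ∈ orbitHull ρ s, p ≤ y := fun y ⟨v, _, hv, _⟩ => (hglb.1 ⟨v, rfl⟩).trans hv
  by_cases hmem : p ∈ range fun v => ρ v s
  · obtain ⟨w, hw⟩ := hmem
    refine ⟨w, fun y hy hwy => ?_⟩
    have : y = p := le_antisymm (hw ▸ hwy) (hle y hy)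
    exact this ▸ hev.self_of_nhds
  · have hlt : p < s := by
      refine lt_of_le_of_ne (hglb.1 ⟨1, by simp⟩) fun h => hmem ⟨1, by simpa using h.symm⟩
    obtain ⟨l, hl, hl'⟩ := exists_Ico_subset_of_mem_nhds hev ⟨s, hlt⟩
    obtain ⟨_, ⟨w, rfl⟩, hw⟩ := (isGLB_lt_iff hglb).1 hl
    exact ⟨w, fun y hy hwy => hl' ⟨hle y hy, hwy.trans_lt hw⟩⟩

/-- Some conjugate of `u` has support disjoint from that of `u` inside a given orbit hull. -/
theorem exists_conj_disjoint {u : G} (hu : u ∈ trivialNearFixed ρ) (s : X) :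
    ∃ k, ∀ y ∈ orbitHull ρ s, ρ u y = y ∨ ρ (k * u * k⁻¹) y = y := by
  obtain ⟨v, hv⟩ := exists_forall_le_orbit_apply_eq_self hu s
  obtain ⟨w, hw⟩ := exists_forall_ge_orbit_apply_eq_self hu s
  refine ⟨w * v⁻¹, fun y hy => ?_⟩
  rcases le_total (ρ w s) y with h | h
  · exact Or.inl (hw y hy h)
  · rw [conj_apply_eq_self_iff]
    refine Or.inr (hv _ (map_mem_orbitHull ρ _ hy) ?_)
    have := (ρ (v * w⁻¹)).monotone h
    rw [mul_inv_rev, inv_inv]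
    refine this.trans_eq ?_
    rw [map_mul]
    exact congrArg (ρ v) (inv_apply_self ρ w s)

theorem exists_finset_support_subset [CompactSpace X] {u : G} (hu : u ∈ trivialNearFixed ρ) :
    ∃ S : Finset X, ∀ y, ρ u y ≠ y → ∃ s ∈ S, y ∈ orbitHull ρ s := by
  classical
  obtain ⟨S, hS⟩ := CompactSpace.elim_nhds_subcover
    (fun x : X => if ∀ v, ρ v x = x then {y | ρ u y = y} else orbitHull ρ x) fun x => by
      split_ifs with h
      · exact hu x h
      · exact (isOpen_orbitHull ρ h).mem_nhds ⟨1, 1, by simp, by simp⟩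
  refine ⟨S, fun y hy => ?_⟩
  have hyS : y ∈ (⊤ : Set X) := trivial
  rw [← hS] at hyS
  simp only [mem_iUnion, exists_prop] at hyS
  obtain ⟨s, hs, hys⟩ := hyS
  split_ifs at hys
  · exact absurd hys hy
  · exact ⟨s, hs, hys⟩

theorem eq_one_of_support_subset [IsFreeGroup G] (hρ : Function.Injective ρ) (S : Finset X) :
    ∀ u ∈ trivialNearFixed ρ, (∀ y, ρ u y ≠ y → ∃ s ∈ S, y ∈ orbitHull ρ s) → u = 1 := by
  classical
  induction S using Finset.induction_on with
  | empty =>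
    intro u _ h
    refine hρ (RelIso.ext fun y => ?_)
    by_contra hy
    obtain ⟨s, hs, _⟩ := h y (by simpa using hy)
    simp at hs
  | insert s S _ ih =>
    intro u hu hsupp
    obtain ⟨k, hk⟩ := exists_conj_disjoint hu s
    have hu' : k * u * k⁻¹ ∈ trivialNearFixed ρ := (normal_trivialNearFixed ρ).conj_mem u hu k
    have hc : ⁅u, k * u * k⁻¹⁆ = 1 := by
      refine ih _ (mul_mem (mul_mem (mul_mem hu hu') (inv_mem hu)) (inv_mem hu')) fun y hy => ?_
      have hys : y ∉ orbitHull ρ s := fun h => hy (commutator_apply_eq_self_of_disjoint ρ hk h)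
      have hmoved : ∃ t ∈ insert s S, y ∈ orbitHull ρ t := by
        by_cases h1 : ρ u y = y
        · by_cases h2 : ρ (k * u * k⁻¹) y = y
          · refine absurd (commutator_apply_eq_self_of_commute ρ _ _ y ?_) hy
            have h3 := ((ρ u).inv_apply_eq_self_iff y).2 h1
            have h4 := ((ρ (k * u * k⁻¹)).inv_apply_eq_self_iff y).2 h2
            rw [← map_inv] at h3 h4
            rw [h4, h3, h2, h1, h2]
          · rw [conj_apply_eq_self_iff] at h2
            obtain ⟨t, ht, hty⟩ := hsupp _ h2
            exact ⟨t, ht, by simpa [apply_inv_self] using map_mem_orbitHull ρ k hty⟩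
        · exact hsupp y h1
      obtain ⟨t, ht, hty⟩ := hmoved
      rcases Finset.mem_insert.1 ht with rfl | ht
      · exact absurd hty hys
      · exact ⟨t, ht, hty⟩
    obtain ⟨z, m, n, hm, hn⟩ :=
      IsFreeGroup.exists_zpow_of_commute (commutatorElement_eq_one_iff_commute.1 hc)
    refine ih u hu fun y hy => ?_
    obtain ⟨t, ht, hty⟩ := hsupp y hy
    rcases Finset.mem_insert.1 ht with rfl | ht
    · exfalso
      have hfix := (hk y hty).resolve_left hy
      rcases eq_or_ne n 0 with rfl | hn0
      · rw [zpow_zero, eq_comm, conj_eq_one_iff] at hn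
        exact hy (by simp [hn])
      · rcases eq_or_ne m 0 with rfl | hm0
        · exact hy (by simp [← hm])
        · rw [← hn, map_zpow, OrderIso.zpow_apply_eq_self_iff _ hn0] at hfix
          rw [← hm, map_zpow, Ne, OrderIso.zpow_apply_eq_self_iff _ hm0] at hy
          exact hy hfix
    · exact ⟨t, ht, hty⟩

/-- In a faithful order-preserving action of a free group on a compact complete linear order, only
the identity acts trivially near every global fixed point. -/
theorem eq_one_of_mem_trivialNearFixed [CompactSpace X] [IsFreeGroup G]
    (hρ : Function.Injective ρ) {u : G} (hu : u ∈ trivialNearFixed ρ) : u = 1 :=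
  let ⟨S, hS⟩ := exists_finset_support_subset hu
  eq_one_of_support_subset hρ S u hu hS

end Order

end Action

section PiecewiseAffine

theorem IsPLHomeo.eventually_nhdsGE {f : Equiv.Perm (Icc (0 : ℝ) 1)} (hf : IsPLHomeo f)
    (x : Icc (0 : ℝ) 1) : ∃ c d : ℝ, ∀ᶠ y in 𝓝[≥] x, (f y : ℝ) = c * y + d := by
  classical
  obtain ⟨-, m, t, hm, h0, h1, -, haff⟩ := hf
  rcases eq_or_ne (x : ℝ) 1 with hx | hx
  · refine ⟨0, f x, ?_⟩
    filter_upwards [self_mem_nhdsWithin] with y hy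
    have : y = x := le_antisymm (Subtype.coe_le_coe.1 (by rw [hx]; exact y.2.2)) hy
    simp [this]
  · have hxm : (x : ℝ) < t m := (lt_of_le_of_ne x.2.2 hx).trans_eq h1.symm
    have hex : ∃ j, (x : ℝ) < t j := ⟨m, hxm⟩
    obtain ⟨i, hi⟩ : ∃ i, Nat.find hex = i + 1 :=
      Nat.exists_eq_succ_of_ne_zero fun h => by
        have := Nat.find_spec hex
        rw [h, h0] at this
        exact absurd x.2.1 (not_le.2 this)
    have hlt : (x : ℝ) < t (i + 1) := hi ▸ Nat.find_spec hex
    have hle : t i ≤ x := not_lt.1 (Nat.find_min hex (by lia))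
    have him : Nat.find hex ≤ m := Nat.find_min' hex hxm
    obtain ⟨c, d, hcd⟩ := haff i (by lia)
    refine ⟨c, d, ?_⟩
    have hev : ∀ᶠ y : Icc (0 : ℝ) 1 in 𝓝 x, (y : ℝ) < t (i + 1) :=
      continuous_subtype_val.continuousAt.eventually_lt_const hlt
    filter_upwards [self_mem_nhdsWithin, nhdsWithin_le_nhds hev] with y hy hy'
    exact hcd y (hle.trans hy) hy'.le

theorem IsPLHomeo.eventually_nhdsLE {f : Equiv.Perm (Icc (0 : ℝ) 1)} (hf : IsPLHomeo f)
    (x : Icc (0 : ℝ) 1) : ∃ c d : ℝ, ∀ᶠ y in 𝓝[≤] x, (f y : ℝ) = c * y + d := by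
  classical
  obtain ⟨-, m, t, hm, h0, h1, -, haff⟩ := hf
  rcases eq_or_ne (x : ℝ) 0 with hx | hx
  · refine ⟨0, f x, ?_⟩
    filter_upwards [self_mem_nhdsWithin] with y hy
    have : y = x := le_antisymm hy (Subtype.coe_le_coe.1 (by rw [hx]; exact y.2.1))
    simp [this]
  · have hxm : (x : ℝ) ≤ t m := x.2.2.trans_eq h1.symm
    have hex : ∃ j, (x : ℝ) ≤ t j := ⟨m, hxm⟩
    obtain ⟨i, hi⟩ : ∃ i, Nat.find hex = i + 1 :=
      Nat.exists_eq_succ_of_ne_zero fun h => by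
        have := Nat.find_spec hex
        rw [h, h0] at this
        exact hx (le_antisymm this x.2.1)
    have hle : (x : ℝ) ≤ t (i + 1) := hi ▸ Nat.find_spec hex
    have hlt : t i < x := not_le.1 (Nat.find_min hex (by lia))
    have him : Nat.find hex ≤ m := Nat.find_min' hex hxm
    obtain ⟨c, d, hcd⟩ := haff i (by lia)
    refine ⟨c, d, ?_⟩
    have hev : ∀ᶠ y : Icc (0 : ℝ) 1 in 𝓝 x, t i < (y : ℝ) :=
      continuous_subtype_val.continuousAt.eventually_const_lt hlt
    filter_upwards [self_mem_nhdsWithin, nhdsWithin_le_nhds hev] with y hy hy'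
    exact hcd y hy'.le ((Subtype.coe_le_coe.2 hy).trans hle)

theorem eventually_commute_of_affine {I : Set ℝ} {f g : I → I} {x : I} {S : Set I}
    (hxS : x ∈ S) (hfx : f x = x) (hgx : g x = x)
    (hf : Tendsto f (𝓝[S] x) (𝓝[S] x)) (hg : Tendsto g (𝓝[S] x) (𝓝[S] x))
    (hfa : ∃ c d : ℝ, ∀ᶠ y in 𝓝[S] x, (f y : ℝ) = c * y + d)
    (hga : ∃ c d : ℝ, ∀ᶠ y in 𝓝[S] x, (g y : ℝ) = c * y + d) :
    ∀ᶠ y in 𝓝[S] x, f (g y) = g (f y) := by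
  obtain ⟨a, b, hab⟩ := hfa
  obtain ⟨c, d, hcd⟩ := hga
  have hb := hab.self_of_nhdsWithin hxS
  have hd := hcd.self_of_nhdsWithin hxS
  rw [hfx] at hb
  rw [hgx] at hd
  filter_upwards [hab, hcd, hg.eventually hab, hf.eventually hcd] with y h1 h2 h3 h4
  ext
  rw [h3, h4, h1, h2]
  linear_combination (1 - a) * hd - (1 - c) * hb

/-- The order isomorphism underlying a piecewise-affine homeomorphism. -/
noncomputable def IsPLHomeo.toOrderIso {f : Equiv.Perm (Icc (0 : ℝ) 1)} (hf : IsPLHomeo f) :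
    Icc (0 : ℝ) 1 ≃o Icc (0 : ℝ) 1 where
  toEquiv := f
  map_rel_iff' {a b} := hf.1.le_iff_le (a := a) (b := b)

theorem IsPLHomeo.eventually_commute {f g : Equiv.Perm (Icc (0 : ℝ) 1)} (hf : IsPLHomeo f)
    (hg : IsPLHomeo g) {x : Icc (0 : ℝ) 1} (hfx : f x = x) (hgx : g x = x) :
    ∀ᶠ y in 𝓝 x, f (g y) = g (f y) := by
  have hcont {h : Equiv.Perm (Icc (0 : ℝ) 1)} (hh : IsPLHomeo h) (hx : h x = x) :
      Tendsto h (𝓝 x) (𝓝 x) := by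
    have := hh.toOrderIso.continuous.tendsto x
    rwa [show hh.toOrderIso x = x from hx] at this
  have hGE {h : Equiv.Perm (Icc (0 : ℝ) 1)} (hh : IsPLHomeo h) (hx : h x = x) :
      Tendsto h (𝓝[≥] x) (𝓝[≥] x) :=
    tendsto_nhdsWithin_iff.2 ⟨(hcont hh hx).mono_left nhdsWithin_le_nhds,
      eventually_nhdsWithin_of_forall fun y hy => hx.ge.trans (hh.toOrderIso.monotone hy)⟩
  have hLE {h : Equiv.Perm (Icc (0 : ℝ) 1)} (hh : IsPLHomeo h) (hx : h x = x) :
      Tendsto h (𝓝[≤] x) (𝓝[≤] x) :=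
    tendsto_nhdsWithin_iff.2 ⟨(hcont hh hx).mono_left nhdsWithin_le_nhds,
      eventually_nhdsWithin_of_forall fun y hy => (hh.toOrderIso.monotone hy).trans hx.le⟩
  rw [← nhdsLE_sup_nhdsGE, eventually_sup]
  exact ⟨eventually_commute_of_affine self_mem_Iic hfx hgx (hLE hf hfx) (hLE hg hgx)
      (hf.eventually_nhdsLE x) (hg.eventually_nhdsLE x),
    eventually_commute_of_affine self_mem_Ici hfx hgx (hGE hf hfx) (hGE hg hgx)
      (hf.eventually_nhdsGE x) (hg.eventually_nhdsGE x)⟩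

end PiecewiseAffine

/-- Brin–Squier. The group of orientation-preserving piecewise-affine
homeomorphisms of `[0,1]` contains no free subgroup of rank 2: for any two such maps
`f, g`, the homomorphism from the free group on two generators sending the generators to
`f` and `g` is not injective. In particular, Thompson's group `F` contains no nonabelian
free subgroup. -/
theorem brin_squier_no_free_subgroup
    (f g : Equiv.Perm (Set.Icc (0 : ℝ) 1)) (hf : IsPLHomeo f) (hg : IsPLHomeo g) :
    ¬ Function.Injective
      ⇑(FreeGroup.lift (fun b : Bool => if b then f else g) :
        FreeGroup Bool →* Equiv.Perm (Set.Icc (0 : ℝ) 1)) := by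
  intro hinj
  let ρ : FreeGroup Bool →* (Set.Icc (0 : ℝ) 1 ≃o Set.Icc (0 : ℝ) 1) :=
    FreeGroup.lift fun b => if b then hf.toOrderIso else hg.toOrderIso
  let toPerm : (Set.Icc (0 : ℝ) 1 ≃o Set.Icc (0 : ℝ) 1) →* Equiv.Perm (Set.Icc (0 : ℝ) 1) :=
    { toFun := fun e => e.toEquiv, map_one' := rfl, map_mul' := fun _ _ => rfl }
  have hcomp : toPerm.comp ρ = FreeGroup.lift fun b : Bool => if b then f else g := by
    ext1 b
    cases b <;> simp [ρ] <;> rfl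
  have hρ : Function.Injective ρ := by
    rw [← hcomp] at hinj
    exact Function.Injective.of_comp (f := toPerm) hinj
  have hρf : ⇑(ρ (FreeGroup.of true)) = f := by simp [ρ]; rfl
  have hρg : ⇑(ρ (FreeGroup.of false)) = g := by simp [ρ]; rfl
  have hmem : ⁅FreeGroup.of true, FreeGroup.of false⁆ ∈ trivialNearFixed ρ := by
    intro x hx
    have hcomm := hf.eventually_commute hg (hρf ▸ hx (FreeGroup.of true))
      (hρg ▸ hx (FreeGroup.of false))
    have ht (v : FreeGroup Bool) : Tendsto (ρ v) (𝓝 x) (𝓝 x) := by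
      simpa only [hx] using (ρ v).continuous.tendsto x
    filter_upwards [((ht (FreeGroup.of true)⁻¹).comp (ht (FreeGroup.of false)⁻¹)).eventually hcomm]
      with y hy
    apply commutator_apply_eq_self_of_commute
    rw [hρf, hρg]
    exact hy
  have hone := eq_one_of_mem_trivialNearFixed hρ hmem
  exact Bool.noConfusion
    (FreeGroup.eq_of_commute_of (commutatorElement_eq_one_iff_commute.1 hone))
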